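/- Let f, g ∈ F_q[x] with deg f = k ≥ 1 and deg g = D ≥ 2, and suppose the pair (f,g) is neither critical nor p-critical. Then the following are equivalent: (i) there exists a constant c > 0 such that m_{f,g}(n) ≤ c for all n ≥ 0; (ii) the sequence (m_{f,g}(n))_{n≥0} is eventually constant; (iii) f has a root β in an algebraic closure of F_q such that g^{(i)}(β) = β for some i ≥ 1. -/

import Mathlib

open Polynomial UniqueFactorizationMonoid
open scoped Classical

/-- The `n`-th compositional iterate of a polynomial `g`. -/
noncomputable def iterPoly {K : Type*} [CommSemiring K] (g : Polynomial K) : ℕ → Polynomial K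
  | 0 => X
  | n + 1 => g.comp (iterPoly g n)

/-- `P_n[f,g] = f(g^{(n)})`. -/
noncomputable def Pn {K : Type*} [CommSemiring K] (f g : Polynomial K) (n : ℕ) : Polynomial K :=
  f.comp (iterPoly g n)

/-- The finset of (normalized) monic irreducible factors of `P`. -/
noncomputable def irrFactors {K : Type*} [Field K] (P : Polynomial K) : Finset (Polynomial K) :=
  (normalizedFactors P).toFinset

/-- Number of distinct irreducible factors of `P`. -/
noncomputable def Nfac {K : Type*} [Field K] (P : Polynomial K) : ℕ := (irrFactors P).card

/-- Degree of the squarefree part of `P`. -/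
noncomputable def Dfac {K : Type*} [Field K] (P : Polynomial K) : ℕ :=
  ∑ r ∈ irrFactors P, r.natDegree

/-- Largest degree of an irreducible factor of `P`. -/
noncomputable def Mfac {K : Type*} [Field K] (P : Polynomial K) : ℕ :=
  (irrFactors P).sup natDegree

/-- Smallest degree of an irreducible factor of `P`. -/
noncomputable def mfac {K : Type*} [Field K] (P : Polynomial K) : ℕ :=
  sInf {d | ∃ r ∈ irrFactors P, r.natDegree = d}

/-- Largest multiplicity in the irreducible factorization of `P`. -/
noncomputable def Efac {K : Type*} [Field K] (P : Polynomial K) : ℕ :=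
  (irrFactors P).sup fun r => (normalizedFactors P).count r

/-- Smallest multiplicity in the irreducible factorization of `P`. -/
noncomputable def efac {K : Type*} [Field K] (P : Polynomial K) : ℕ :=
  sInf {e | ∃ r ∈ irrFactors P, (normalizedFactors P).count r = e}

/-- Largest multiplicity of a root of `P` in an algebraic closure. -/
noncomputable def nuMax {K : Type*} [Field K] (P : Polynomial K) : ℕ :=
  Efac (P.map (algebraMap K (AlgebraicClosure K)))

/-- Smallest multiplicity of a root of `P` in an algebraic closure. -/
noncomputable def nuMin {K : Type*} [Field K] (P : Polynomial K) : ℕ :=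
  efac (P.map (algebraMap K (AlgebraicClosure K)))

/-- The pair `(f, g)` is `p`-critical: `g = a x^{p^h} + b`. -/
def IsPCritical {K : Type*} [Field K] (p : ℕ) (_f g : Polynomial K) : Prop :=
  ∃ (h : ℕ) (a b : K), g = C a * X ^ p ^ h + C b

/-- The pair `(f, g)` is critical: `f = β (x-α)^{deg f}` and `g = γ (x-α)^{deg g} + α`. -/
def IsCritical {K : Type*} [Field K] (f g : Polynomial K) : Prop :=
  ∃ α β γ : K, f = C β * (X - C α) ^ f.natDegree ∧
    g = C γ * (X - C α) ^ g.natDegree + C α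

section Preliminaries

variable {K : Type*} [Field K]

theorem natDegree_iterPoly (g : K[X]) (n : ℕ) : (iterPoly g n).natDegree = g.natDegree ^ n := by
  induction n with
  | zero => simp [iterPoly]
  | succ n ih => rw [iterPoly, natDegree_comp, ih, pow_succ']

theorem natDegree_Pn (f g : K[X]) (n : ℕ) :
    (Pn f g n).natDegree = f.natDegree * g.natDegree ^ n := by
  rw [Pn, natDegree_comp, natDegree_iterPoly]

theorem aeval_iterPoly {A : Type*} [CommSemiring A] [Algebra K A] (g : K[X]) (n : ℕ) (x : A) :
    aeval x (iterPoly g n) = (fun y : A => aeval y g)^[n] x := by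
  induction n with
  | zero => simp [iterPoly]
  | succ n ih => rw [iterPoly, aeval_comp, ih, Function.iterate_succ_apply']

theorem aeval_Pn {A : Type*} [CommSemiring A] [Algebra K A] (f g : K[X]) (n : ℕ) (x : A) :
    aeval x (Pn f g n) = aeval ((fun y : A => aeval y g)^[n] x) f := by
  rw [Pn, aeval_comp, aeval_iterPoly]

theorem minpoly_mem_irrFactors {L : Type*} [Field L] [Algebra K L] [Algebra.IsAlgebraic K L]
    {P : K[X]} (hP : P ≠ 0) {x : L} (hx : aeval x P = 0) : minpoly K x ∈ irrFactors P := by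
  have hi : IsIntegral K x := Algebra.IsIntegral.isIntegral x
  rw [irrFactors, Multiset.mem_toFinset, Polynomial.mem_normalizedFactors_iff hP]
  exact ⟨minpoly.irreducible hi, minpoly.monic hi, minpoly.dvd K x hx⟩

theorem exists_minpoly_eq_of_mem_irrFactors {L : Type*} [Field L] [Algebra K L] [IsAlgClosed L]
    {P r : K[X]} (hP : P ≠ 0) (hr : r ∈ irrFactors P) :
    ∃ x : L, aeval x P = 0 ∧ minpoly K x = r := by
  rw [irrFactors, Multiset.mem_toFinset, Polynomial.mem_normalizedFactors_iff hP] at hr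
  obtain ⟨hirr, hmon, hdvd⟩ := hr
  obtain ⟨x, hx⟩ := IsAlgClosed.exists_aeval_eq_zero L r hirr.degree_pos.ne'
  exact ⟨x, aeval_eq_zero_of_dvd_aeval_eq_zero hdvd hx,
    (minpoly.eq_of_irreducible_of_monic hirr hx hmon).symm⟩

theorem mfac_le_of_aeval_eq_zero {L : Type*} [Field L] [Algebra K L] [Algebra.IsAlgebraic K L]
    {P : K[X]} (hP : P ≠ 0) {x : L} (hx : aeval x P = 0) : mfac P ≤ (minpoly K x).natDegree :=
  Nat.sInf_le ⟨_, minpoly_mem_irrFactors hP hx, rfl⟩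

theorem exists_natDegree_minpoly_eq_mfac (L : Type*) [Field L] [Algebra K L] [IsAlgClosed L]
    [Algebra.IsAlgebraic K L] {P : K[X]} (hP : P.natDegree ≠ 0) :
    ∃ x : L, aeval x P = 0 ∧ (minpoly K x).natDegree = mfac P := by
  have hP0 : P ≠ 0 := by
    rintro rfl
    simp at hP
  obtain ⟨y, hy⟩ := IsAlgClosed.exists_aeval_eq_zero L P fun h =>
    hP (natDegree_eq_of_degree_eq_some h)
  obtain ⟨r, hr, hd⟩ : mfac P ∈ {d | ∃ r ∈ irrFactors P, r.natDegree = d} :=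
    Nat.sInf_mem ⟨_, _, minpoly_mem_irrFactors hP0 hy, rfl⟩
  obtain ⟨x, hx, rfl⟩ := exists_minpoly_eq_of_mem_irrFactors (L := L) hP0 hr
  exact ⟨x, hx, hd⟩

theorem natDegree_minpoly_aeval_le {L : Type*} [Field L] [Algebra K L] [Algebra.IsAlgebraic K L]
    (g : K[X]) (x : L) : (minpoly K (aeval x g)).natDegree ≤ (minpoly K x).natDegree := by
  have hx : IsIntegral K x := Algebra.IsIntegral.isIntegral x
  have hgx : IsIntegral K (aeval x g) := Algebra.IsIntegral.isIntegral _
  rw [← IntermediateField.adjoin.finrank hx, ← IntermediateField.adjoin.finrank hgx]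
  have := IntermediateField.adjoin.finiteDimensional hx
  refine IntermediateField.finrank_le_of_le_right ?_
  rw [IntermediateField.adjoin_simple_le_iff]
  exact IntermediateField.algebra_adjoin_le_adjoin K {x} (aeval_mem_adjoin_singleton K x)

theorem natDegree_minpoly_iterate_aeval_le {L : Type*} [Field L] [Algebra K L]
    [Algebra.IsAlgebraic K L] (g : K[X]) (n : ℕ) (x : L) :
    (minpoly K ((fun y : L => aeval y g)^[n] x)).natDegree ≤ (minpoly K x).natDegree := by
  induction n with
  | zero => rfl
  | succ n ih =>
    rw [Function.iterate_succ_apply']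
    exact (natDegree_minpoly_aeval_le g _).trans ih

theorem finite_setOf_natDegree_minpoly_le (L : Type*) [Field L] [Algebra K L] [Finite K]
    [Algebra.IsAlgebraic K L] (c : ℕ) : {x : L | (minpoly K x).natDegree ≤ c}.Finite := by
  refine (bUnion_roots_finite (algebraMap K L) c (Set.toFinite Set.univ)).subset fun x hx => ?_
  have hi : IsIntegral K x := Algebra.IsIntegral.isIntegral x
  simp only [Set.mem_iUnion]
  refine ⟨minpoly K x, ⟨hx, by simp⟩, ?_⟩
  simp [minpoly.ne_zero hi]

theorem monotone_mfac_Pn {f g : K[X]} (hf : f.natDegree ≠ 0) (hg : g.natDegree ≠ 0) :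
    Monotone fun n => mfac (Pn f g n) := by
  have hdeg (n : ℕ) : (Pn f g n).natDegree ≠ 0 := by
    rw [natDegree_Pn]
    exact mul_ne_zero hf (pow_ne_zero n hg)
  refine monotone_nat_of_le_succ fun n => ?_
  obtain ⟨x, hx, hd⟩ := exists_natDegree_minpoly_eq_mfac (AlgebraicClosure K) (hdeg (n + 1))
  rw [aeval_Pn, Function.iterate_succ_apply, ← aeval_Pn] at hx
  rw [← hd]
  exact (mfac_le_of_aeval_eq_zero (ne_zero_of_natDegree_gt (Nat.pos_of_ne_zero (hdeg n))) hx).trans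
    (natDegree_minpoly_aeval_le g x)

end Preliminaries

/-- If the first `n + 1` points of an orbit lie in a finite set with at most `n` elements, then the
`n`-th iterate is a periodic point. -/
theorem iterate_mem_periodicPts_of_card_le {α : Type*} {G : α → α} {s : Finset α} {x : α} {n : ℕ}
    (hs : ∀ i ≤ n, G^[i] x ∈ s) (hn : s.card ≤ n) : G^[n] x ∈ Function.periodicPts G := by
  obtain ⟨i, hi, j, hj, hij, h⟩ := Finset.exists_ne_map_eq_of_card_lt_of_maps_to
    (s := Finset.range (n + 1)) (t := s) (f := fun i => G^[i] x) (by simpa using by omega)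
    (fun i hi => hs i (by simp at hi; omega))
  simp only [Finset.mem_range] at hi hj h
  wlog hlt : i < j generalizing i j
  · exact this j i hij.symm h.symm hj hi (by omega)
  refine Function.mk_mem_periodicPts (Nat.sub_pos_of_lt hlt) ?_
  have hper : Function.IsPeriodicPt G (j - i) (G^[i] x) := by
    rw [Function.IsPeriodicPt, Function.IsFixedPt, ← Function.iterate_add_apply,
      Nat.sub_add_cancel hlt.le, h]
  have := hper.apply_iterate (n - i)
  rwa [← Function.iterate_add_apply, Nat.sub_add_cancel (by omega)] at this

theorem stmt5 {K : Type*} [Field K] [Fintype K] {p : ℕ} [Fact p.Prime] [CharP K p]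
    (f g : Polynomial K) (k D : ℕ)
    (hfk : f.natDegree = k) (hk : 1 ≤ k)
    (hgD : g.natDegree = D) (hD : 2 ≤ D)
    (hcrit : ¬ IsCritical f g) (hpcrit : ¬ IsPCritical p f g) :
    ((∃ c : ℝ, 0 < c ∧ ∀ n : ℕ, (mfac (Pn f g n) : ℝ) ≤ c) ↔
      (∃ n₀ : ℕ, ∀ n : ℕ, n₀ ≤ n → mfac (Pn f g n) = mfac (Pn f g n₀))) ∧
    ((∃ n₀ : ℕ, ∀ n : ℕ, n₀ ≤ n → mfac (Pn f g n) = mfac (Pn f g n₀)) ↔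
      (∃ β : AlgebraicClosure K, aeval β f = 0 ∧
        ∃ i : ℕ, 1 ≤ i ∧ aeval β (iterPoly g i) = β)) := by
  have hf0 : f.natDegree ≠ 0 := by omega
  have hg0 : g.natDegree ≠ 0 := by omega
  have hdeg (n : ℕ) : (Pn f g n).natDegree ≠ 0 := by
    rw [natDegree_Pn]
    exact mul_ne_zero hf0 (pow_ne_zero n hg0)
  have hmono := monotone_mfac_Pn hf0 hg0
  have eventually_const_of_bounded : (∃ c : ℝ, 0 < c ∧ ∀ n : ℕ, (mfac (Pn f g n) : ℝ) ≤ c) →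
      ∃ n₀ : ℕ, ∀ n : ℕ, n₀ ≤ n → mfac (Pn f g n) = mfac (Pn f g n₀) := by
    rintro ⟨c, -, hc⟩
    have hbdd : BddAbove (Set.range fun n => mfac (Pn f g n)) :=
      ⟨⌊c⌋₊, by rintro _ ⟨n, rfl⟩; exact Nat.le_floor (hc n)⟩
    obtain ⟨n₀, hn₀⟩ := Nat.sSup_mem (Set.range_nonempty _) hbdd
    exact ⟨n₀, fun n hn => le_antisymm
      ((le_csSup hbdd ⟨n, rfl⟩).trans_eq hn₀.symm) (hmono hn)⟩
  have periodic_of_eventually_const :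
      (∃ n₀ : ℕ, ∀ n : ℕ, n₀ ≤ n → mfac (Pn f g n) = mfac (Pn f g n₀)) →
      ∃ β : AlgebraicClosure K, aeval β f = 0 ∧
        ∃ i : ℕ, 1 ≤ i ∧ aeval β (iterPoly g i) = β := by
    rintro ⟨n₀, hn₀⟩
    have hfin := finite_setOf_natDegree_minpoly_le (K := K) (AlgebraicClosure K)
      (mfac (Pn f g n₀))
    set n := max n₀ hfin.toFinset.card
    obtain ⟨x, hx, hd⟩ := exists_natDegree_minpoly_eq_mfac (AlgebraicClosure K) (hdeg n)
    rw [hn₀ n (le_max_left _ _)] at hd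
    rw [aeval_Pn] at hx
    obtain ⟨i, hi, hper⟩ := iterate_mem_periodicPts_of_card_le (s := hfin.toFinset) (x := x)
      (fun i _ => by
        rw [Set.Finite.mem_toFinset]
        exact (natDegree_minpoly_iterate_aeval_le g i x).trans_eq hd) (le_max_right n₀ _)
    exact ⟨_, hx, i, hi, by rw [aeval_iterPoly]; exact hper⟩
  have bounded_of_periodic : (∃ β : AlgebraicClosure K, aeval β f = 0 ∧
        ∃ i : ℕ, 1 ≤ i ∧ aeval β (iterPoly g i) = β) →
      ∃ c : ℝ, 0 < c ∧ ∀ n : ℕ, (mfac (Pn f g n) : ℝ) ≤ c := by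
    rintro ⟨β, hβ, i, hi, hper⟩
    rw [aeval_iterPoly] at hper
    have hβi : IsIntegral K β := Algebra.IsIntegral.isIntegral β
    refine ⟨(minpoly K β).natDegree, by exact_mod_cast minpoly.natDegree_pos hβi, fun n => ?_⟩
    have hle : n ≤ n * i := Nat.le_mul_of_pos_right n hi
    have hroot : aeval ((fun y : AlgebraicClosure K => aeval y g)^[n * i - n] β) (Pn f g n) = 0 := by
      rw [aeval_Pn, ← Function.iterate_add_apply, Nat.add_sub_cancel' hle,
        (Function.IsPeriodicPt.const_mul hper n).eq, hβ]
    exact_mod_cast (mfac_le_of_aeval_eq_zero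
      (ne_zero_of_natDegree_gt (Nat.pos_of_ne_zero (hdeg n))) hroot).trans
      (natDegree_minpoly_iterate_aeval_le g _ β)
  exact ⟨⟨eventually_const_of_bounded, fun h => bounded_of_periodic (periodic_of_eventually_const h)⟩,
    ⟨periodic_of_eventually_const, fun h => eventually_const_of_bounded (bounded_of_periodic h)⟩⟩
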